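/- Assume c > 0 and A_{i,j} ≥ κ hᵢ for all i, j, with κ > 0. Let u ∈ W̃_β^{2,∞} be an exact solution of the interface problem −(βu′)′ + γu′ + cu = f on (a,α) ∪ (α,b) with u(a) = u(b) = 0, and let u_T ∈ U_T be an IFVM solution with the same data f. Then there exist constants h₀ > 0 and C > 0, depending only on p, β⁻, β⁺, γ, c, κ and b−a, such that whenever h ≤ h₀, the quasi-optimal error bound ‖u − u_T‖_G ≤ C · inf_{v ∈ U_T} ‖u − v‖_G holds. -/

import Mathlib

open Set

/-- The piecewise-constant diffusion coefficient with interface point `α`. -/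
noncomputable def betaPW (βm βp α : ℝ) : ℝ → ℝ := fun t => if t < α then βm else βp

/-- Membership in the immersed trial space `U_T`: continuous on `[a,b]`, zero boundary
values, a polynomial of degree ≤ p on each non-interface element `[x_{i-1}, x_i]` (i ≠ k),
and on the interface element `[x_{k-1}, x_k]` a continuous piecewise polynomial of degree ≤ p
satisfying the derivative jump conditions at the interface `α`. -/
def MemUT (p N k : ℕ) (a b α βm βp : ℝ) (x : ℕ → ℝ) (v : ℝ → ℝ) : Prop :=
  ContinuousOn v (Set.Icc a b) ∧ v a = 0 ∧ v b = 0 ∧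
  (∀ i, 1 ≤ i → i ≤ N → i ≠ k → ∃ q : Polynomial ℝ, q.natDegree ≤ p ∧
    ∀ y ∈ Set.Icc (x (i - 1)) (x i), v y = q.eval y) ∧
  ∃ qm qp : Polynomial ℝ, qm.natDegree ≤ p ∧ qp.natDegree ≤ p ∧
    (∀ y ∈ Set.Icc (x (k - 1)) α, v y = qm.eval y) ∧
    (∀ y ∈ Set.Icc α (x k), v y = qp.eval y) ∧
    ∀ j, 1 ≤ j → j ≤ p →
      βm * ((⇑Polynomial.derivative)^[j] qm).eval α
        = βp * ((⇑Polynomial.derivative)^[j] qp).eval α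

/-- Membership in `W̃_β^{m,∞}`: continuous on `[a,b]`, zero boundary values, `C^m` on each
of `[a,α]` and `[α,b]`, and satisfying the flux jump conditions at `α` for `j = 1,…,m`. -/
def MemW (m : ℕ) (a b α βm βp : ℝ) (u : ℝ → ℝ) : Prop :=
  ContinuousOn u (Set.Icc a b) ∧ u a = 0 ∧ u b = 0 ∧
  ContDiffOn ℝ (m : ℕ∞) u (Set.Icc a α) ∧ ContDiffOn ℝ (m : ℕ∞) u (Set.Icc α b) ∧
  ∀ j, 1 ≤ j → j ≤ m →
    βm * iteratedDerivWithin j u (Set.Icc a α) α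
      = βp * iteratedDerivWithin j u (Set.Icc α b) α

/-- The squared discrete flux seminorm `|u|²_G = Σᵢ Σⱼ A_{i,j} (β(g_{i,j}) u′(g_{i,j}))²`. -/
noncomputable def gseminormSq (N p : ℕ) (βm βp α : ℝ) (g A : ℕ → ℕ → ℝ) (u : ℝ → ℝ) : ℝ :=
  ∑ i ∈ Finset.Icc 1 N, ∑ j ∈ Finset.Icc 1 p,
    A i j * (betaPW βm βp α (g i j) * deriv u (g i j)) ^ 2

/-- The discrete energy norm `‖u‖_G`, where `‖u‖²_G = |u|²_G + ‖u‖²₁`. -/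
noncomputable def gnorm (N p : ℕ) (a b βm βp α : ℝ) (g A : ℕ → ℕ → ℝ) (u : ℝ → ℝ) : ℝ :=
  Real.sqrt (gseminormSq N p βm βp α g A u + ∫ t in a..b, ((deriv u t) ^ 2 + (u t) ^ 2))

/-- Continuous functions on `[a, b]` that are differentiable with bounded derivative off a
countable set. -/
def PiecewiseC1 (a b : ℝ) (u : ℝ → ℝ) : Prop :=
  ContinuousOn u (Set.Icc a b) ∧ ∃ S : Set ℝ, S.Countable ∧ ∃ M : ℝ,
    ∀ t ∈ Set.Ioo a b \ S, DifferentiableAt ℝ u t ∧ |deriv u t| ≤ M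

theorem ae_mem_Ioo_diff {S : Set ℝ} (hS : S.Countable) (a b : ℝ) :
    ∀ᵐ t ∂(MeasureTheory.volume.restrict (Set.Ioc a b)), t ∈ Set.Ioo a b \ S := by
  have h1 : ∀ᵐ t ∂(MeasureTheory.volume.restrict (Set.Ioc a b)), t ∉ insert b S :=
    (hS.insert b).ae_notMem _
  filter_upwards [h1, MeasureTheory.ae_restrict_mem measurableSet_Ioc] with t ht1 ht2
  simp only [Set.mem_insert_iff, not_or] at ht1
  exact ⟨⟨ht2.1, lt_of_le_of_ne ht2.2 ht1.1⟩, ht1.2⟩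

theorem intervalIntegrable_of_bounded_off_countable {φ : ℝ → ℝ} {a b M : ℝ} {S : Set ℝ}
    (hab : a ≤ b) (hS : S.Countable)
    (hm : MeasureTheory.AEStronglyMeasurable φ (MeasureTheory.volume.restrict (Set.Ioc a b)))
    (hM : ∀ t ∈ Set.Ioo a b \ S, |φ t| ≤ M) :
    IntervalIntegrable φ MeasureTheory.volume a b := by
  rw [intervalIntegrable_iff_integrableOn_Ioc_of_le hab]
  refine MeasureTheory.Integrable.mono' (g := fun _ => M)
    (MeasureTheory.integrable_const M) hm ?_
  filter_upwards [ae_mem_Ioo_diff hS a b] with t ht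
  exact hM t ht

theorem intervalIntegral_congr_off_countable {φ ψ : ℝ → ℝ} {a b : ℝ} {S : Set ℝ}
    (hab : a ≤ b) (hS : S.Countable) (h : ∀ t ∈ Set.Ioo a b \ S, φ t = ψ t) :
    ∫ t in a..b, φ t = ∫ t in a..b, ψ t := by
  rw [intervalIntegral.integral_of_le hab, intervalIntegral.integral_of_le hab]
  refine MeasureTheory.integral_congr_ae ?_
  filter_upwards [ae_mem_Ioo_diff hS a b] with t ht
  exact h t ht

theorem intervalIntegral_mono_off_countable {φ ψ : ℝ → ℝ} {a b : ℝ} {S : Set ℝ}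
    (hab : a ≤ b) (hS : S.Countable) (hφ : IntervalIntegrable φ MeasureTheory.volume a b)
    (hψ : IntervalIntegrable ψ MeasureTheory.volume a b)
    (h : ∀ t ∈ Set.Ioo a b \ S, φ t ≤ ψ t) :
    ∫ t in a..b, φ t ≤ ∫ t in a..b, ψ t := by
  rw [intervalIntegral.integral_of_le hab, intervalIntegral.integral_of_le hab]
  rw [intervalIntegrable_iff_integrableOn_Ioc_of_le hab] at hφ hψ
  refine MeasureTheory.integral_mono_ae hφ hψ ?_
  filter_upwards [ae_mem_Ioo_diff hS a b] with t ht
  exact h t ht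

theorem sq_intervalIntegral_le {φ : ℝ → ℝ} {s t : ℝ} (hst : s ≤ t)
    (h1 : IntervalIntegrable φ MeasureTheory.volume s t)
    (h2 : IntervalIntegrable (fun y => φ y ^ 2) MeasureTheory.volume s t) :
    (∫ y in s..t, φ y) ^ 2 ≤ (t - s) * ∫ y in s..t, φ y ^ 2 := by
  rcases hst.eq_or_lt with rfl | hlt
  · simp
  set I := ∫ y in s..t, φ y with hI
  have h0 : 0 ≤ ∫ y in s..t, ((t - s) * φ y - I) ^ 2 :=
    intervalIntegral.integral_nonneg hst fun y _ => sq_nonneg _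
  have he : ∫ y in s..t, ((t - s) * φ y - I) ^ 2
      = (t - s) ^ 2 * (∫ y in s..t, φ y ^ 2) - 2 * (t - s) * I * I + (t - s) * I ^ 2 := by
    have : ∀ y, ((t - s) * φ y - I) ^ 2
        = ((t - s) ^ 2 * φ y ^ 2 - 2 * (t - s) * I * φ y) + I ^ 2 := fun y => by ring
    simp_rw [this]
    rw [intervalIntegral.integral_add ((h2.const_mul _).sub (h1.const_mul _))
      intervalIntegrable_const, intervalIntegral.integral_sub (h2.const_mul _) (h1.const_mul _),
      intervalIntegral.integral_const_mul, intervalIntegral.integral_const_mul,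
      intervalIntegral.integral_const, smul_eq_mul]
  rw [he] at h0
  have hpos : 0 < t - s := sub_pos.2 hlt
  refine le_of_mul_le_mul_left ?_ hpos
  nlinarith

namespace PiecewiseC1

variable {a b s t l r : ℝ} {u w : ℝ → ℝ}

theorem sub (hu : PiecewiseC1 a b u) (hw : PiecewiseC1 a b w) :
    PiecewiseC1 a b (fun t => u t - w t) := by
  obtain ⟨hc, S, hS, M, hM⟩ := hu
  obtain ⟨hc', S', hS', M', hM'⟩ := hw
  refine ⟨hc.sub hc', S ∪ S', hS.union hS', M + M', fun t ht => ?_⟩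
  have hn : t ∉ S ∧ t ∉ S' := by simpa [not_or] using ht.2
  obtain ⟨d, e⟩ := hM t ⟨ht.1, hn.1⟩
  obtain ⟨d', e'⟩ := hM' t ⟨ht.1, hn.2⟩
  refine ⟨d.sub d', ?_⟩
  rw [deriv_fun_sub d d']
  exact (abs_sub _ _).trans (add_le_add e e')

theorem mono (hu : PiecewiseC1 a b u) (hl : a ≤ l) (hr : r ≤ b) : PiecewiseC1 l r u := by
  obtain ⟨hc, S, hS, M, hM⟩ := hu
  exact ⟨hc.mono (Set.Icc_subset_Icc hl hr), S, hS, M, fun t ht =>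
    hM t ⟨⟨hl.trans_lt ht.1.1, ht.1.2.trans_le hr⟩, ht.2⟩⟩

theorem intervalIntegrable (hu : PiecewiseC1 a b u) (hab : a ≤ b) :
    IntervalIntegrable u MeasureTheory.volume a b :=
  hu.1.intervalIntegrable_of_Icc hab

theorem intervalIntegrable_sq (hu : PiecewiseC1 a b u) (hab : a ≤ b) :
    IntervalIntegrable (fun t => u t ^ 2) MeasureTheory.volume a b :=
  (hu.1.pow 2).intervalIntegrable_of_Icc hab

theorem intervalIntegrable_deriv (hu : PiecewiseC1 a b u) (hab : a ≤ b) :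
    IntervalIntegrable (deriv u) MeasureTheory.volume a b := by
  obtain ⟨-, S, hS, M, hM⟩ := hu
  exact intervalIntegrable_of_bounded_off_countable hab hS
    (measurable_deriv u).aestronglyMeasurable fun t ht => (hM t ht).2

theorem intervalIntegrable_deriv_sq (hu : PiecewiseC1 a b u) (hab : a ≤ b) :
    IntervalIntegrable (fun t => deriv u t ^ 2) MeasureTheory.volume a b := by
  obtain ⟨-, S, hS, M, hM⟩ := hu
  refine intervalIntegrable_of_bounded_off_countable (M := M ^ 2) hab hS
    ((measurable_deriv u).pow_const 2).aestronglyMeasurable fun t ht => ?_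
  rw [abs_pow]
  exact pow_le_pow_left₀ (abs_nonneg _) (hM t ht).2 2

theorem integral_deriv (hu : PiecewiseC1 a b u) (hab : a ≤ b) :
    ∫ y in a..b, deriv u y = u b - u a := by
  have hi := hu.intervalIntegrable_deriv hab
  obtain ⟨hc, S, hS, M, hM⟩ := hu
  exact MeasureTheory.integral_eq_of_hasDerivAt_off_countable_of_le u (deriv u) hab hS hc
    (fun t ht => (hM t ht).1.hasDerivAt) hi

theorem sq_sub_le (hu : PiecewiseC1 l r u) (hs : s ∈ Set.Icc l r) (ht : t ∈ Set.Icc l r) :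
    (u s - u t) ^ 2 ≤ (r - l) * ∫ y in l..r, deriv u y ^ 2 := by
  wlog hst : t ≤ s generalizing s t
  · rw [sub_sq_comm]
    exact this ht hs (le_of_not_ge hst)
  have hlr : l ≤ r := hs.1.trans hs.2
  have hu' := hu.mono ht.1 hs.2
  rw [← hu'.integral_deriv hst]
  have h1 := sq_intervalIntegral_le hst (hu'.intervalIntegrable_deriv hst)
    (hu'.intervalIntegrable_deriv_sq hst)
  have h2 : ∫ y in t..s, deriv u y ^ 2 ≤ ∫ y in l..r, deriv u y ^ 2 :=
    intervalIntegral.integral_mono_interval ht.1 hst hs.2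
      (Filter.Eventually.of_forall fun y => sq_nonneg _) (hu.intervalIntegrable_deriv_sq hlr)
  have h3 : 0 ≤ ∫ y in t..s, deriv u y ^ 2 :=
    intervalIntegral.integral_nonneg hst fun y _ => sq_nonneg _
  refine h1.trans (mul_le_mul ?_ h2 h3 (sub_nonneg.2 hlr))
  linarith [ht.1, hs.2]

theorem sq_sub_integral_le (hu : PiecewiseC1 a b u) {M : ℝ} (hal : a ≤ l) (hlt : l ≤ t)
    (htb : t ≤ b) (hM : ∀ y ∈ Set.Icc a b, u y ^ 2 ≤ M) :
    ((∫ y in a..t, u y) - ∫ y in a..l, u y) ^ 2 ≤ (t - l) ^ 2 * M := by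
  have h1 := (hu.mono le_rfl htb).intervalIntegrable (hal.trans hlt)
  have h2 := (hu.mono le_rfl (hlt.trans htb)).intervalIntegrable hal
  have hu' := hu.mono hal htb
  rw [intervalIntegral.integral_interval_sub_left h1 h2]
  have h3 := sq_intervalIntegral_le hlt (hu'.intervalIntegrable hlt)
    (hu'.intervalIntegrable_sq hlt)
  have h4 : ∫ y in l..t, u y ^ 2 ≤ ∫ _ in l..t, M :=
    intervalIntegral.integral_mono_on hlt (hu'.intervalIntegrable_sq hlt)
      intervalIntegrable_const fun y hy => hM y ⟨hal.trans hy.1, hy.2.trans htb⟩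
  rw [intervalIntegral.integral_const, smul_eq_mul] at h4
  calc _ ≤ _ := h3
    _ ≤ (t - l) * ((t - l) * M) := mul_le_mul_of_nonneg_left h4 (sub_nonneg.2 hlt)
    _ = _ := by ring

end PiecewiseC1

theorem betaPW_pos {βm βp : ℝ} (hm : 0 < βm) (hp : 0 < βp) (α t : ℝ) :
    0 < betaPW βm βp α t := by
  unfold betaPW; split_ifs <;> assumption

theorem inv_betaPW_le {βm βp : ℝ} (hm : 0 < βm) (hp : 0 < βp) (α t : ℝ) :
    1 / betaPW βm βp α t ≤ 1 / βm + 1 / βp := by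
  have h1 : 0 < 1 / βm := by positivity
  have h2 : 0 < 1 / βp := by positivity
  unfold betaPW; split_ifs <;> linarith

theorem measurable_betaPW (βm βp α : ℝ) : Measurable (betaPW βm βp α) :=
  Measurable.ite measurableSet_Iio measurable_const measurable_const

namespace MemW

variable {a b α βm βp : ℝ} {u : ℝ → ℝ}

theorem contDiffAt (hu : MemW 2 a b α βm βp u) {t : ℝ}
    (ht : t ∈ Set.Ioo a α ∪ Set.Ioo α b) : ContDiffAt ℝ 2 u t := by
  obtain ⟨-, -, -, h1, h2, -⟩ := hu
  rcases ht with ht | ht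
  · exact h1.contDiffAt (Icc_mem_nhds ht.1 ht.2)
  · exact h2.contDiffAt (Icc_mem_nhds ht.1 ht.2)

theorem differentiableAt (hu : MemW 2 a b α βm βp u) {t : ℝ}
    (ht : t ∈ Set.Ioo a α ∪ Set.Ioo α b) : DifferentiableAt ℝ u t :=
  (hu.contDiffAt ht).differentiableAt (by norm_num)

theorem differentiableAt_deriv (hu : MemW 2 a b α βm βp u) {t : ℝ}
    (ht : t ∈ Set.Ioo a α ∪ Set.Ioo α b) : DifferentiableAt ℝ (deriv u) t :=
  ((hu.contDiffAt ht).derivWithin (m := 1) (by norm_num)).differentiableAt (by norm_num)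

/-- The flux `β u'` of a member of `W̃_β^{2,∞}` extends continuously to the closed interval. -/
theorem exists_flux (hu : MemW 2 a b α βm βp u) (haα : a < α) (hαb : α < b) :
    ∃ ψ : ℝ → ℝ, ContinuousOn ψ (Set.Icc a b) ∧
      ∀ t ∈ Set.Ioo a α ∪ Set.Ioo α b, ψ t = betaPW βm βp α t * deriv u t := by
  obtain ⟨-, -, -, h1, h2, h3⟩ := hu
  have hj := h3 1 le_rfl (by norm_num)
  rw [iteratedDerivWithin_one, iteratedDerivWithin_one] at hj
  have c1 := h1.continuousOn_derivWithin (uniqueDiffOn_Icc haα) (by norm_num)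
  have c2 := h2.continuousOn_derivWithin (uniqueDiffOn_Icc hαb) (by norm_num)
  refine ⟨fun t => if t < α then βm * derivWithin u (Set.Icc a α) t
    else βp * derivWithin u (Set.Icc α b) t, ?_, ?_⟩
  · rw [← Set.Icc_union_Icc_eq_Icc haα.le hαb.le]
    refine ContinuousOn.union_of_isClosed ?_ ?_ isClosed_Icc isClosed_Icc
    · refine (continuousOn_const.mul c1 : ContinuousOn
        (fun t => βm * derivWithin u (Set.Icc a α) t) _).congr fun t ht => ?_
      rcases ht.2.lt_or_eq with h | h
      · simp [h]
      · simp [h, hj]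
    · refine (continuousOn_const.mul c2 : ContinuousOn
        (fun t => βp * derivWithin u (Set.Icc α b) t) _).congr fun t ht => ?_
      simp [not_lt.2 ht.1]
  · rintro t (ht | ht)
    · simp only [betaPW, ht.2, if_true]
      rw [derivWithin_of_mem_nhds (Icc_mem_nhds ht.1 ht.2)]
    · simp only [betaPW, not_lt.2 ht.1.le, if_false]
      rw [derivWithin_of_mem_nhds (Icc_mem_nhds ht.1 ht.2)]

theorem mem_Ioo_union {t : ℝ} (ht : t ∈ Set.Ioo a b) (hα : t ≠ α) :
    t ∈ Set.Ioo a α ∪ Set.Ioo α b := by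
  rcases lt_or_gt_of_ne hα with h | h
  · exact Or.inl ⟨ht.1, h⟩
  · exact Or.inr ⟨h, ht.2⟩

theorem piecewiseC1 (hu : MemW 2 a b α βm βp u) (haα : a < α) (hαb : α < b)
    (hm : 0 < βm) (hp : 0 < βp) : PiecewiseC1 a b u := by
  obtain ⟨ψ, hψ, he⟩ := hu.exists_flux haα hαb
  obtain ⟨M, hM⟩ := isCompact_Icc.exists_bound_of_continuousOn hψ
  refine ⟨hu.1, {α}, Set.countable_singleton α, (1 / βm + 1 / βp) * M, fun t ht => ?_⟩
  have ht' := mem_Ioo_union ht.1 (by simpa using ht.2)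
  refine ⟨hu.differentiableAt ht', ?_⟩
  have hb := betaPW_pos hm hp α t
  have hM' := hM t (Set.Ioo_subset_Icc_self ht.1)
  have : deriv u t = 1 / betaPW βm βp α t * ψ t := by
    rw [he t ht']; field_simp
  rw [this, abs_mul, abs_of_pos (by positivity : 0 < 1 / betaPW βm βp α t)]
  exact mul_le_mul (inv_betaPW_le hm hp α t) hM' (abs_nonneg _) (by positivity)

/-- The conservation law satisfied by an exact solution on a control volume. -/
theorem conservation (hu : MemW 2 a b α βm βp u) (haα : a < α) (hαb : α < b)
    (hm : 0 < βm) (hp : 0 < βp) {γ c : ℝ} {f : ℝ → ℝ}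
    (hf : ContinuousOn f (Set.Ioo a α ∪ Set.Ioo α b))
    (hfb : ∃ Mf : ℝ, ∀ t ∈ Set.Icc a b, |f t| ≤ Mf)
    (hpde : ∀ t, t ∈ Set.Ioo a α ∪ Set.Ioo α b →
      -(betaPW βm βp α t * iteratedDeriv 2 u t) + γ * deriv u t + c * u t = f t)
    {s t : ℝ} (hs : s ∈ Set.Ioo a b) (hsα : s ≠ α) (ht : t ∈ Set.Ioo a b) (htα : t ≠ α)
    (hst : s ≤ t) :
    betaPW βm βp α s * deriv u s - betaPW βm βp α t * deriv u t
      + (∫ y in s..t, (γ * deriv u y + c * u y)) = ∫ y in s..t, f y := by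
  have hpc := (hu.piecewiseC1 haα hαb hm hp).mono hs.1.le ht.2.le
  have hsub : Set.Ioo s t ⊆ Set.Ioo a b := Set.Ioo_subset_Ioo hs.1.le ht.2.le
  obtain ⟨ψ, hψ, he⟩ := hu.exists_flux haα hαb
  obtain ⟨M, hM⟩ := hfb
  have hfi : IntervalIntegrable f MeasureTheory.volume s t := by
    refine intervalIntegrable_of_bounded_off_countable (S := {α}) (M := M) hst
      (Set.countable_singleton α) ?_ fun y hy => hM y (Set.Ioo_subset_Icc_self (hsub hy.1))
    have h1 : MeasureTheory.AEStronglyMeasurable f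
        (MeasureTheory.volume.restrict (Set.Ioo s t \ {α})) := by
      refine (hf.mono fun y hy => mem_Ioo_union (hsub hy.1) (by simpa using hy.2)).aestronglyMeasurable
        (measurableSet_Ioo.diff (measurableSet_singleton α))
    have h2 : MeasureTheory.volume.restrict (Set.Ioo s t \ {α})
        = MeasureTheory.volume.restrict (Set.Ioc s t) :=
      MeasureTheory.Measure.restrict_congr_set
        ((MeasureTheory.sdiff_null_ae_eq_self Real.volume_singleton).trans
          MeasureTheory.Ioo_ae_eq_Ioc)
    rwa [h2] at h1
  have hgi : IntervalIntegrable (fun y => γ * deriv u y + c * u y) MeasureTheory.volume s t :=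
    ((hpc.intervalIntegrable_deriv hst).const_mul γ).add ((hpc.intervalIntegrable hst).const_mul c)
  have hftc := MeasureTheory.integral_eq_of_hasDerivAt_off_countable_of_le ψ
    (fun y => (γ * deriv u y + c * u y) - f y) hst (Set.countable_singleton α)
    (hψ.mono (Set.Icc_subset_Icc hs.1.le ht.2.le)) (fun y hy => by
      have hy' := mem_Ioo_union (hsub hy.1) (by simpa using hy.2)
      have hopen : IsOpen (Set.Ioo a α ∪ Set.Ioo α b) := isOpen_Ioo.union isOpen_Ioo
      have hd : HasDerivAt (deriv u) (iteratedDeriv 2 u y) y := by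
        rw [iteratedDeriv_succ, iteratedDeriv_one]
        exact (hu.differentiableAt_deriv hy').hasDerivAt
      have hval : γ * deriv u y + c * u y - f y = betaPW βm βp α y * iteratedDeriv 2 u y := by
        rw [← hpde y hy']; ring
      rw [hval]
      refine (hd.const_mul (betaPW βm βp α y)).congr_of_eventuallyEq ?_
      have hconst : ∀ᶠ z in nhds y, betaPW βm βp α z = betaPW βm βp α y := by
        rcases hy' with h | h
        · filter_upwards [Iio_mem_nhds h.2] with z hz
          simp only [betaPW, if_pos h.2, if_pos (Set.mem_Iio.1 hz)]
        · filter_upwards [Ioi_mem_nhds h.1] with z hz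
          simp only [betaPW, if_neg (not_lt.2 h.1.le), if_neg (not_lt.2 (Set.mem_Ioi.1 hz).le)]
      filter_upwards [hconst, hopen.mem_nhds hy'] with z hz1 hz2
      rw [he z hz2, hz1]) (hgi.sub hfi)
  rw [intervalIntegral.integral_sub hgi hfi, he s (mem_Ioo_union hs hsα),
    he t (mem_Ioo_union ht htα)] at hftc
  linarith

end MemW

theorem Polynomial.eq_zero_of_iterate_derivative_eval_eq_zero {D : Polynomial ℝ} {α : ℝ}
    (h : ∀ m ≤ D.natDegree, ((⇑Polynomial.derivative)^[m] D).eval α = 0) : D = 0 := by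
  by_contra hD
  have h1 := (Polynomial.lt_rootMultiplicity_iff_isRoot_iterate_derivative
    (n := D.natDegree) (t := α) hD).2 h
  have h3 := Polynomial.natDegree_le_of_dvd (D.pow_rootMultiplicity_dvd α) hD
  rw [(Polynomial.monic_X_sub_C α).natDegree_pow, Polynomial.natDegree_X_sub_C] at h3
  omega

/-- On every element the flux `β w'` coincides with a polynomial of degree at most `p - 1`. -/
def HasPolynomialFlux (p N : ℕ) (βm βp α : ℝ) (x : ℕ → ℝ) (w : ℝ → ℝ) : Prop :=
  ∀ i ∈ Finset.Icc 1 N, ∃ P : Polynomial ℝ, P.natDegree ≤ p - 1 ∧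
    ∀ t ∈ Set.Ioo (x (i - 1)) (x i), t ≠ α →
      DifferentiableAt ℝ w t ∧ betaPW βm βp α t * deriv w t = P.eval t

theorem HasPolynomialFlux.sub {p N : ℕ} {βm βp α : ℝ} {x : ℕ → ℝ} {u w : ℝ → ℝ}
    (hu : HasPolynomialFlux p N βm βp α x u) (hw : HasPolynomialFlux p N βm βp α x w) :
    HasPolynomialFlux p N βm βp α x (fun t => u t - w t) := by
  intro i hi
  obtain ⟨P, hP, h⟩ := hu i hi
  obtain ⟨Q, hQ, h'⟩ := hw i hi
  refine ⟨P - Q, (Polynomial.natDegree_sub_le _ _).trans (max_le hP hQ), fun t ht hα => ?_⟩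
  obtain ⟨d, e⟩ := h t ht hα
  obtain ⟨d', e'⟩ := h' t ht hα
  refine ⟨d.sub d', ?_⟩
  rw [deriv_fun_sub d d', mul_sub, e, e', Polynomial.eval_sub]

theorem mesh_lt {N : ℕ} {x : ℕ → ℝ} (hx : ∀ i, i < N → x i < x (i + 1)) {i j : ℕ}
    (hij : i < j) (hj : j ≤ N) : x i < x j := by
  induction j, hij using Nat.le_induction with
  | base => exact hx i hj
  | succ j hij ih => exact (ih (by omega)).trans (hx j hj)

theorem mesh_le {N : ℕ} {x : ℕ → ℝ} (hx : ∀ i, i < N → x i < x (i + 1)) {i j : ℕ}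
    (hij : i ≤ j) (hj : j ≤ N) : x i ≤ x j := by
  rcases hij.eq_or_lt with rfl | h
  · exact le_rfl
  · exact (mesh_lt hx h hj).le

theorem exists_mem_mesh_Ioo {N : ℕ} {x : ℕ → ℝ} {t : ℝ} (h0 : x 0 < t) (hN : t < x N)
    (ht : t ∉ Set.range x) : ∃ i ∈ Finset.Icc 1 N, t ∈ Set.Ioo (x (i - 1)) (x i) := by
  classical
  have hex : ∃ i, t < x i := ⟨N, hN⟩
  have hpos : Nat.find hex ≠ 0 := fun h => by
    have := Nat.find_spec hex
    rw [h] at this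
    exact lt_asymm h0 this
  refine ⟨Nat.find hex, Finset.mem_Icc.2 ⟨by omega, Nat.find_min' hex hN⟩, ?_,
    Nat.find_spec hex⟩
  refine lt_of_le_of_ne (not_lt.1 (Nat.find_min hex (by omega))) fun h => ht ⟨_, h⟩

theorem HasPolynomialFlux.piecewiseC1 {p N : ℕ} {βm βp α : ℝ} {x : ℕ → ℝ} {w : ℝ → ℝ}
    (hw : HasPolynomialFlux p N βm βp α x w) (hm : 0 < βm) (hp : 0 < βp)
    (hc : ContinuousOn w (Set.Icc (x 0) (x N))) : PiecewiseC1 (x 0) (x N) w := by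
  have hb : ∀ i, ∃ M, 0 ≤ M ∧ (i ∈ Finset.Icc 1 N → ∀ t ∈ Set.Ioo (x (i - 1)) (x i), t ≠ α →
      DifferentiableAt ℝ w t ∧ |deriv w t| ≤ M) := by
    intro i
    by_cases hi : i ∈ Finset.Icc 1 N
    · obtain ⟨P, -, hP⟩ := hw i hi
      obtain ⟨M, hM⟩ := isCompact_Icc.exists_bound_of_continuousOn
        (P.continuous.continuousOn (s := Set.Icc (x (i - 1)) (x i)))
      refine ⟨(1 / βm + 1 / βp) * |M|, by positivity, fun _ t ht hα => ?_⟩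
      obtain ⟨d, e⟩ := hP t ht hα
      refine ⟨d, ?_⟩
      have hb := betaPW_pos hm hp α t
      have : deriv w t = 1 / betaPW βm βp α t * P.eval t := by
        rw [← e]; field_simp
      rw [this, abs_mul, abs_of_pos (by positivity : 0 < 1 / betaPW βm βp α t)]
      exact mul_le_mul (inv_betaPW_le hm hp α t)
        ((hM t (Set.Ioo_subset_Icc_self ht)).trans (le_abs_self M)) (abs_nonneg _) (by positivity)
    · exact ⟨0, le_rfl, fun h => absurd h hi⟩
  choose M hM0 hM using hb
  refine ⟨hc, insert α (Set.range x), (Set.countable_range x).insert α,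
    ∑ i ∈ Finset.Icc 1 N, M i, fun t ht => ?_⟩
  have hn := ht.2
  simp only [Set.mem_insert_iff, not_or] at hn
  obtain ⟨i, hi, hti⟩ := exists_mem_mesh_Ioo ht.1.1 ht.1.2 hn.2
  obtain ⟨d, e⟩ := hM i hi t hti hn.1
  exact ⟨d, e.trans (Finset.single_le_sum (f := M) (fun j _ => hM0 j) hi)⟩

theorem hasDerivAt_of_eqOn_eval {w : ℝ → ℝ} {q : Polynomial ℝ} {l r t : ℝ}
    (h : ∀ y ∈ Set.Icc l r, w y = q.eval y) (ht : t ∈ Set.Ioo l r) :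
    HasDerivAt w (q.derivative.eval t) t := by
  refine (q.hasDerivAt t).congr_of_eventuallyEq ?_
  filter_upwards [Icc_mem_nhds ht.1 ht.2] with y hy using h y hy

theorem MemUT.hasPolynomialFlux {p N k : ℕ} {a b α βm βp : ℝ} {x : ℕ → ℝ} {v : ℝ → ℝ}
    (hv : MemUT p N k a b α βm βp x v) (hp : 1 ≤ p) (hx : ∀ i, i < N → x i < x (i + 1))
    (hkN : k ≤ N) (hk1 : x (k - 1) < α) (hk2 : α < x k) :
    HasPolynomialFlux p N βm βp α x v := by
  obtain ⟨-, -, -, hreg, qm, qp, hdm, hdp, hqm, hqp, hjump⟩ := hv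
  have hdeg : ∀ (β : ℝ) (q : Polynomial ℝ), q.natDegree ≤ p →
      (Polynomial.C β * Polynomial.derivative q).natDegree ≤ p - 1 := fun β q hq =>
    (Polynomial.natDegree_C_mul_le _ _).trans
      ((Polynomial.natDegree_derivative_le q).trans (Nat.sub_le_sub_right hq 1))
  intro i hi
  rw [Finset.mem_Icc] at hi
  rcases eq_or_ne i k with rfl | hik
  · have heq : Polynomial.C βm * Polynomial.derivative qm
        = Polynomial.C βp * Polynomial.derivative qp := by
      rw [← sub_eq_zero]
      refine Polynomial.eq_zero_of_iterate_derivative_eval_eq_zero (α := α) fun m hm => ?_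
      have hm' : m ≤ p - 1 := hm.trans
        ((Polynomial.natDegree_sub_le _ _).trans (max_le (hdeg _ _ hdm) (hdeg _ _ hdp)))
      have := hjump (m + 1) (by omega) (by omega)
      simp only [Function.iterate_succ, Function.comp] at this
      simp [Polynomial.iterate_derivative_C_mul, this]
    refine ⟨Polynomial.C βm * Polynomial.derivative qm, hdeg _ _ hdm, fun t ht hα => ?_⟩
    rcases lt_or_gt_of_ne hα with h | h
    · have hd := hasDerivAt_of_eqOn_eval hqm ⟨ht.1, h⟩
      exact ⟨hd.differentiableAt, by simp [betaPW, h, hd.deriv]⟩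
    · have hd := hasDerivAt_of_eqOn_eval hqp ⟨h, ht.2⟩
      refine ⟨hd.differentiableAt, ?_⟩
      rw [heq]
      simp [betaPW, not_lt.2 h.le, hd.deriv]
  · obtain ⟨q, hq, hqe⟩ := hreg i hi.1 hi.2 hik
    rcases lt_or_gt_of_ne hik with h | h
    · refine ⟨Polynomial.C βm * Polynomial.derivative q, hdeg _ _ hq, fun t ht _ => ?_⟩
      have hd := hasDerivAt_of_eqOn_eval hqe ht
      have hlt : t < α := ht.2.trans ((mesh_le hx (by omega : i ≤ k - 1) (by omega)).trans_lt hk1)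
      exact ⟨hd.differentiableAt, by simp [betaPW, hlt, hd.deriv]⟩
    · refine ⟨Polynomial.C βp * Polynomial.derivative q, hdeg _ _ hq, fun t ht _ => ?_⟩
      have hd := hasDerivAt_of_eqOn_eval hqe ht
      have hlt : α < t := (hk2.trans_le (mesh_le hx (by omega : k ≤ i - 1) (by omega))).trans ht.1
      exact ⟨hd.differentiableAt, by simp [betaPW, not_lt.2 hlt.le, hd.deriv]⟩

/-- A mesh with positive quadrature rules for the weight `1 / β` on its elements, exact on
polynomials of degree at most `2 p - 1`, and with mesh size at most `h`. -/
structure IsQuadratureMesh (p N : ℕ) (βm βp α h : ℝ) (x : ℕ → ℝ) (g A : ℕ → ℕ → ℝ) : Prop where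
  step : ∀ i, i < N → x i < x (i + 1)
  node_mem : ∀ i ∈ Finset.Icc 1 N, ∀ j ∈ Finset.Icc 1 p, g i j ∈ Set.Ioo (x (i - 1)) (x i)
  node_ne : ∀ i ∈ Finset.Icc 1 N, ∀ j ∈ Finset.Icc 1 p, g i j ≠ α
  weight_pos : ∀ i ∈ Finset.Icc 1 N, ∀ j ∈ Finset.Icc 1 p, 0 < A i j
  exact_on : ∀ i ∈ Finset.Icc 1 N, ∀ F : Polynomial ℝ, F.natDegree ≤ 2 * p - 1 →
    ∑ j ∈ Finset.Icc 1 p, A i j * F.eval (g i j)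
      = ∫ t in (x (i - 1))..(x i), F.eval t / betaPW βm βp α t
  size_le : ∀ i ∈ Finset.Icc 1 N, x i - x (i - 1) ≤ h

theorem sum_Icc_sub_pred (F : ℕ → ℝ) (N : ℕ) :
    ∑ i ∈ Finset.Icc 1 N, (F i - F (i - 1)) = F N - F 0 := by
  induction N with
  | zero => simp
  | succ n ih => rw [Finset.sum_Icc_succ_top (by omega), ih]; simp

/-- If the nodal values `q` of the flux, `ω` of the function and `Ω` of its primitive on one
element oscillate little, the lower order terms are controlled by the flux up to telescoping
terms. -/
theorem element_estimate {ι : Type*} (s : Finset ι) {A q ω Ω : ι → ℝ}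
    {B h ℓ D M w0 w1 W0 W1 γ c : ℝ} (hA : ∀ j ∈ s, 0 ≤ A j) (hB : 0 < B) (hh : 0 < h)
    (hℓ : ℓ ≤ h) (hM : 0 ≤ M) (hc : 0 ≤ c) (hsum : ∑ j ∈ s, A j ≤ B * ℓ)
    (hq : ∑ j ∈ s, A j * q j = w1 - w0) (hD : ∑ j ∈ s, A j * q j ^ 2 = D)
    (hω : ∀ j ∈ s, (ω j - (w0 + w1) / 2) ^ 2 ≤ h * (B * D))
    (hΩ : ∀ j ∈ s, (Ω j - W0) ^ 2 ≤ h ^ 2 * M)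
    (hW : -(w1 * (W1 - W0)) ≤ h ^ 2 * (B * D) / 2) :
    ∑ j ∈ s, A j * ((γ * ω j + c * Ω j) * q j)
      ≤ γ / 2 * (w1 ^ 2 - w0 ^ 2) + c * (W1 * w1 - W0 * w0) + |γ| * B * h * D
        + c * (h / 2) * (M * (B * ℓ) + D) + c * (h ^ 2 * (B * D) / 2) := by
  have hD0 : 0 ≤ D := hD ▸ Finset.sum_nonneg fun j hj => mul_nonneg (hA j hj) (sq_nonneg _)
  set m := (w0 + w1) / 2 with hm
  have hpt : ∀ j ∈ s, A j * ((γ * ω j + c * Ω j) * q j)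
      ≤ A j * q j * (γ * m + c * W0) + A j * (|γ| * (D / 2) + c * (h / 2 * M))
        + A j * q j ^ 2 * (|γ| * (B * h / 2) + c * (h / 2)) := by
    intro j hj
    have e1 : γ * ((ω j - m) * q j) ≤ |γ| * (D / 2 + B * h * q j ^ 2 / 2) := by
      refine (le_abs_self _).trans ?_
      rw [abs_mul]
      refine mul_le_mul_of_nonneg_left ?_ (abs_nonneg _)
      have hBh : 0 < B * h := mul_pos hB hh
      refine abs_le_of_sq_le_sq ?_ (by positivity)
      have h1 := hω j hj
      have h2 : ((ω j - m) * q j) ^ 2 ≤ h * (B * D) * q j ^ 2 := by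
        rw [mul_pow]; exact mul_le_mul_of_nonneg_right h1 (sq_nonneg _)
      nlinarith [sq_nonneg (D - B * h * q j ^ 2)]
    have e2 : (Ω j - W0) * q j ≤ h / 2 * (M + q j ^ 2) := by
      refine le_of_abs_le (abs_le_of_sq_le_sq ?_ (by positivity))
      have h2 : ((Ω j - W0) * q j) ^ 2 ≤ h ^ 2 * M * q j ^ 2 := by
        rw [mul_pow]; exact mul_le_mul_of_nonneg_right (hΩ j hj) (sq_nonneg _)
      nlinarith [mul_nonneg (sq_nonneg h) (sq_nonneg (M - q j ^ 2))]
    have e3 := mul_le_mul_of_nonneg_left (add_le_add e1 (mul_le_mul_of_nonneg_left e2 hc)) (hA j hj)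
    linarith
  refine (Finset.sum_le_sum hpt).trans ?_
  rw [Finset.sum_add_distrib, Finset.sum_add_distrib, ← Finset.sum_mul, ← Finset.sum_mul,
    ← Finset.sum_mul, hq, hD]
  have e4 : (∑ j ∈ s, A j) * (|γ| * (D / 2) + c * (h / 2 * M))
      ≤ B * ℓ * (|γ| * (D / 2) + c * (h / 2 * M)) :=
    mul_le_mul_of_nonneg_right hsum (by positivity)
  have e5 : B * ℓ * (|γ| * (D / 2)) ≤ B * h * (|γ| * (D / 2)) :=
    mul_le_mul_of_nonneg_right (mul_le_mul_of_nonneg_left hℓ hB.le) (by positivity)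
  have e6 := mul_le_mul_of_nonneg_left hW hc
  rw [hm]
  linarith

namespace IsQuadratureMesh

variable {p N : ℕ} {βm βp α h : ℝ} {x : ℕ → ℝ} {g A : ℕ → ℕ → ℝ} {w : ℝ → ℝ} {i : ℕ}

theorem pred_lt (H : IsQuadratureMesh p N βm βp α h x g A) (hi : i ∈ Finset.Icc 1 N) :
    x (i - 1) < x i := by
  rw [Finset.mem_Icc] at hi
  exact mesh_lt H.step (by omega) hi.2

theorem first_le (H : IsQuadratureMesh p N βm βp α h x g A) (hi : i ∈ Finset.Icc 1 N) :
    x 0 ≤ x (i - 1) := by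
  rw [Finset.mem_Icc] at hi
  exact mesh_le H.step (by omega) (by omega)

theorem le_last (H : IsQuadratureMesh p N βm βp α h x g A) (hi : i ∈ Finset.Icc 1 N) :
    x i ≤ x N :=
  mesh_le H.step (Finset.mem_Icc.1 hi).2 le_rfl

theorem intervalIntegrable_inv (hβm : 0 < βm) (hβp : 0 < βp) {l r : ℝ} (hlr : l ≤ r) :
    IntervalIntegrable (fun t => 1 / betaPW βm βp α t) MeasureTheory.volume l r := by
  refine intervalIntegrable_of_bounded_off_countable (M := 1 / βm + 1 / βp) hlr
    Set.countable_empty ((measurable_betaPW βm βp α).const_div 1).aestronglyMeasurable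
    fun t _ => ?_
  have := betaPW_pos hβm hβp α t
  rw [abs_of_pos (by positivity)]
  exact inv_betaPW_le hβm hβp α t

theorem sum_weight_le (H : IsQuadratureMesh p N βm βp α h x g A) (hβm : 0 < βm) (hβp : 0 < βp)
    (hi : i ∈ Finset.Icc 1 N) :
    ∑ j ∈ Finset.Icc 1 p, A i j ≤ (1 / βm + 1 / βp) * (x i - x (i - 1)) := by
  have h1 := H.exact_on i hi 1 (by simp)
  simp only [Polynomial.eval_one, mul_one] at h1
  rw [h1]
  have hlt := (H.pred_lt hi).le
  have h2 := intervalIntegral.integral_mono_on hlt (intervalIntegrable_inv hβm hβp hlt)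
    intervalIntegrable_const fun t _ => inv_betaPW_le hβm hβp α t
  rw [intervalIntegral.integral_const, smul_eq_mul, mul_comm] at h2
  exact h2

theorem sum_flux (H : IsQuadratureMesh p N βm βp α h x g A) (hβm : 0 < βm) (hβp : 0 < βp)
    (hw : PiecewiseC1 (x 0) (x N) w) (hP : HasPolynomialFlux p N βm βp α x w)
    (hi : i ∈ Finset.Icc 1 N) :
    ∑ j ∈ Finset.Icc 1 p, A i j * (betaPW βm βp α (g i j) * deriv w (g i j))
      = w (x i) - w (x (i - 1)) := by
  obtain ⟨P, hdeg, hP⟩ := hP i hi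
  have hlt := (H.pred_lt hi).le
  rw [← (hw.mono (H.first_le hi) (H.le_last hi)).integral_deriv hlt]
  have h1 : ∑ j ∈ Finset.Icc 1 p, A i j * (betaPW βm βp α (g i j) * deriv w (g i j))
      = ∑ j ∈ Finset.Icc 1 p, A i j * P.eval (g i j) :=
    Finset.sum_congr rfl fun j hj => by
      rw [(hP _ (H.node_mem i hi j hj) (H.node_ne i hi j hj)).2]
  rw [h1, H.exact_on i hi P (by omega)]
  refine intervalIntegral_congr_off_countable hlt (Set.countable_singleton α) fun t ht => ?_
  have hb := betaPW_pos hβm hβp α t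
  rw [← (hP t ht.1 (by simpa using ht.2)).2]
  field_simp

theorem integral_deriv_sq_le (H : IsQuadratureMesh p N βm βp α h x g A) (hβm : 0 < βm)
    (hβp : 0 < βp) (hp : 1 ≤ p) (hw : PiecewiseC1 (x 0) (x N) w)
    (hP : HasPolynomialFlux p N βm βp α x w) (hi : i ∈ Finset.Icc 1 N) :
    ∫ t in (x (i - 1))..(x i), deriv w t ^ 2 ≤ (1 / βm + 1 / βp) *
      ∑ j ∈ Finset.Icc 1 p, A i j * (betaPW βm βp α (g i j) * deriv w (g i j)) ^ 2 := by
  obtain ⟨P, hdeg, hP⟩ := hP i hi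
  have hlt := (H.pred_lt hi).le
  have h1 : ∑ j ∈ Finset.Icc 1 p, A i j * (betaPW βm βp α (g i j) * deriv w (g i j)) ^ 2
      = ∑ j ∈ Finset.Icc 1 p, A i j * (P ^ 2).eval (g i j) :=
    Finset.sum_congr rfl fun j hj => by
      rw [(hP _ (H.node_mem i hi j hj) (H.node_ne i hi j hj)).2, Polynomial.eval_pow]
  rw [h1, H.exact_on i hi (P ^ 2) (Polynomial.natDegree_pow_le.trans (by omega)),
    ← intervalIntegral.integral_const_mul]
  have hint : IntervalIntegrable (fun t => (P ^ 2).eval t / betaPW βm βp α t)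
      MeasureTheory.volume (x (i - 1)) (x i) := by
    have := (intervalIntegrable_inv (α := α) hβm hβp hlt).continuousOn_mul
      (P ^ 2).continuous.continuousOn
    simpa only [mul_one_div] using this
  refine intervalIntegral_mono_off_countable hlt (Set.countable_singleton α)
    ((hw.mono (H.first_le hi) (H.le_last hi)).intervalIntegrable_deriv_sq hlt)
    (hint.const_mul _) fun t ht => ?_
  have hb := betaPW_pos hβm hβp α t
  rw [Polynomial.eval_pow, ← (hP t ht.1 (by simpa using ht.2)).2]
  calc deriv w t ^ 2
      = 1 / betaPW βm βp α t * ((betaPW βm βp α t * deriv w t) ^ 2 / betaPW βm βp α t) := by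
        field_simp
    _ ≤ _ := mul_le_mul_of_nonneg_right (inv_betaPW_le hβm hβp α t) (by positivity)

theorem sum_integral (H : IsQuadratureMesh p N βm βp α h x g A) {φ : ℝ → ℝ}
    (hφ : IntervalIntegrable φ MeasureTheory.volume (x 0) (x N)) :
    ∑ i ∈ Finset.Icc 1 N, ∫ t in (x (i - 1))..(x i), φ t = ∫ t in (x 0)..(x N), φ t := by
  have hsub : ∀ n ≤ N, IntervalIntegrable φ MeasureTheory.volume (x 0) (x n) := fun n hn =>
    hφ.mono_set (by
      rw [Set.uIcc_of_le (mesh_le H.step n.zero_le hn),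
        Set.uIcc_of_le (mesh_le H.step N.zero_le le_rfl)]
      exact Set.Icc_subset_Icc_right (mesh_le H.step hn le_rfl))
  have h1 := sum_Icc_sub_pred (fun n => ∫ t in (x 0)..(x n), φ t) N
  simp only [intervalIntegral.integral_same, sub_zero] at h1
  rw [← h1]
  refine Finset.sum_congr rfl fun i hi => ?_
  rw [Finset.mem_Icc] at hi
  rw [intervalIntegral.integral_interval_sub_left (hsub i hi.2) (hsub (i - 1) (by omega))]

end IsQuadratureMesh

namespace IsQuadratureMesh

variable {p N : ℕ} {βm βp α h : ℝ} {x : ℕ → ℝ} {g A : ℕ → ℕ → ℝ} {w : ℝ → ℝ} {i : ℕ}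

theorem integral_deriv_sq_le_gseminormSq (H : IsQuadratureMesh p N βm βp α h x g A)
    (hβm : 0 < βm) (hβp : 0 < βp) (hp : 1 ≤ p) (hw : PiecewiseC1 (x 0) (x N) w)
    (hP : HasPolynomialFlux p N βm βp α x w) :
    ∫ t in (x 0)..(x N), deriv w t ^ 2 ≤ (1 / βm + 1 / βp) * gseminormSq N p βm βp α g A w := by
  rw [← H.sum_integral (hw.intervalIntegrable_deriv_sq (mesh_le H.step N.zero_le le_rfl)),
    gseminormSq, Finset.mul_sum]
  exact Finset.sum_le_sum fun i hi => H.integral_deriv_sq_le hβm hβp hp hw hP hi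

theorem gseminormSq_nonneg (H : IsQuadratureMesh p N βm βp α h x g A) (u : ℝ → ℝ) :
    0 ≤ gseminormSq N p βm βp α g A u :=
  Finset.sum_nonneg fun i hi => Finset.sum_nonneg fun j hj =>
    mul_nonneg (H.weight_pos i hi j hj).le (sq_nonneg _)

theorem sum_length (x : ℕ → ℝ) (N : ℕ) : ∑ i ∈ Finset.Icc 1 N, (x i - x (i - 1)) = x N - x 0 :=
  sum_Icc_sub_pred x N

theorem lower_order_le (H : IsQuadratureMesh p N βm βp α h x g A) (hβm : 0 < βm)
    (hβp : 0 < βp) (hp : 1 ≤ p) (hh : 0 < h) {γ c M : ℝ} (hc : 0 ≤ c)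
    (hw : PiecewiseC1 (x 0) (x N) w) (hP : HasPolynomialFlux p N βm βp α x w)
    (hM : ∀ y ∈ Set.Icc (x 0) (x N), w y ^ 2 ≤ M) (hi : i ∈ Finset.Icc 1 N) {B D : ℝ}
    (hB : B = 1 / βm + 1 / βp)
    (hD : ∑ j ∈ Finset.Icc 1 p, A i j * (betaPW βm βp α (g i j) * deriv w (g i j)) ^ 2 = D) :
    ∑ j ∈ Finset.Icc 1 p, A i j * ((γ * w (g i j) + c * ∫ t in (x 0)..(g i j), w t)
        * (betaPW βm βp α (g i j) * deriv w (g i j)))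
      ≤ γ / 2 * (w (x i) ^ 2 - w (x (i - 1)) ^ 2)
        + c * ((∫ t in (x 0)..(x i), w t) * w (x i)
          - (∫ t in (x 0)..(x (i - 1)), w t) * w (x (i - 1)))
        + |γ| * B * h * D + c * (h / 2) * (M * (B * (x i - x (i - 1))) + D)
        + c * (h ^ 2 * (B * D) / 2) := by
  have hlt := H.pred_lt hi
  have h0 := H.first_le hi
  have hN := H.le_last hi
  have hsz := H.size_le i hi
  have hB0 : 0 < B := by rw [hB]; positivity
  have hwi := hw.mono h0 hN
  have hd := H.integral_deriv_sq_le hβm hβp hp hw hP hi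
  rw [hD, ← hB] at hd
  have hd0 : 0 ≤ ∫ t in (x (i - 1))..(x i), deriv w t ^ 2 :=
    intervalIntegral.integral_nonneg hlt.le fun _ _ => sq_nonneg _
  have hosc : ∀ s ∈ Set.Icc (x (i - 1)) (x i), ∀ t ∈ Set.Icc (x (i - 1)) (x i),
      (w s - w t) ^ 2 ≤ h * (B * D) := fun s hs t ht =>
    (hwi.sq_sub_le hs ht).trans (mul_le_mul hsz hd hd0 hh.le)
  have hl : x (i - 1) ∈ Set.Icc (x (i - 1)) (x i) := Set.left_mem_Icc.2 hlt.le
  have hr : x i ∈ Set.Icc (x (i - 1)) (x i) := Set.right_mem_Icc.2 hlt.le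
  have hM0 : 0 ≤ M := (sq_nonneg _).trans (hM (x (i - 1)) ⟨h0, hlt.le.trans hN⟩)
  refine element_estimate (Finset.Icc 1 p) (fun j hj => (H.weight_pos i hi j hj).le) hB0 hh hsz
    hM0 hc (hB ▸ H.sum_weight_le hβm hβp hi) (H.sum_flux hβm hβp hw hP hi) hD ?_ ?_ ?_
  · intro j hj
    have hg := Set.Ioo_subset_Icc_self (H.node_mem i hi j hj)
    nlinarith [hosc _ hg _ hl, hosc _ hg _ hr, sq_nonneg (w (x (i - 1)) - w (x i))]
  · intro j hj
    have hg := H.node_mem i hi j hj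
    refine (hw.sq_sub_integral_le h0 hg.1.le (hg.2.le.trans hN) hM).trans
      (mul_le_mul_of_nonneg_right (pow_le_pow_left₀ (sub_nonneg.2 hg.1.le) ?_ 2) hM0)
    linarith [hg.2]
  · have hlen : x 0 ≤ x i := h0.trans hlt.le
    rw [intervalIntegral.integral_interval_sub_left
      ((hw.mono le_rfl hN).intervalIntegrable hlen)
      ((hw.mono le_rfl (hlt.le.trans hN)).intervalIntegrable h0),
      ← intervalIntegral.integral_const_mul, ← intervalIntegral.integral_neg]
    have h1 := intervalIntegral.integral_mono_on (g := fun _ => h * (B * D) / 2) hlt.le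
      ((hwi.intervalIntegrable hlt.le).const_mul (w (x i))).neg
      intervalIntegrable_const fun t ht => by
        have := hosc _ hr t ht
        change -(w (x i) * w t) ≤ h * (B * D) / 2
        nlinarith [sq_nonneg (w (x i)), sq_nonneg (w t)]
    rw [intervalIntegral.integral_const, smul_eq_mul] at h1
    refine h1.trans ?_
    have h2 : 0 ≤ h * (B * D) / 2 := by
      have := hosc _ hr _ hl
      linarith [sq_nonneg (w (x i) - w (x (i - 1)))]
    calc _ ≤ h * (h * (B * D) / 2) := mul_le_mul_of_nonneg_right hsz h2
      _ = _ := by ring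

/-- Discrete coercivity: if the nodal fluxes of `w` solve the integrated discrete equations with
residual `r`, then they are controlled by `r` on sufficiently fine meshes. -/
theorem gseminormSq_le_of_residual (H : IsQuadratureMesh p N βm βp α h x g A) (hβm : 0 < βm)
    (hβp : 0 < βp) (hp : 1 ≤ p) (hh : 0 < h) (hh1 : h ≤ 1) {γ c K B : ℝ} {r : ℕ → ℕ → ℝ}
    (hc : 0 ≤ c) (hB : B = 1 / βm + 1 / βp)
    (hsmall : h * (|γ| * B + c / 2 * (B ^ 2 * (x N - x 0) ^ 2 + 1) + c * B / 2) ≤ 1 / 4)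
    (hw : PiecewiseC1 (x 0) (x N) w) (hP : HasPolynomialFlux p N βm βp α x w)
    (hw0 : w (x 0) = 0) (hwN : w (x N) = 0)
    (heq : ∀ i ∈ Finset.Icc 1 N, ∀ j ∈ Finset.Icc 1 p,
      betaPW βm βp α (g i j) * deriv w (g i j)
        = r i j + K + (γ * w (g i j) + c * ∫ t in (x 0)..(g i j), w t)) :
    (∀ y ∈ Set.Icc (x 0) (x N),
      w y ^ 2 ≤ (x N - x 0) * (B * gseminormSq N p βm βp α g A w)) ∧
    gseminormSq N p βm βp α g A w
      ≤ 2 * ∑ i ∈ Finset.Icc 1 N, ∑ j ∈ Finset.Icc 1 p, A i j * r i j ^ 2 := by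
  have h0N : x 0 ≤ x N := mesh_le H.step N.zero_le le_rfl
  have hB0 : 0 < B := by rw [hB]; positivity
  set D := gseminormSq N p βm βp α g A w with hDdef
  have hD0 : 0 ≤ D := H.gseminormSq_nonneg w
  set d := x N - x 0 with hd
  have hd0 : 0 ≤ d := sub_nonneg.2 h0N
  have hsup : ∀ y ∈ Set.Icc (x 0) (x N), w y ^ 2 ≤ d * (B * D) := by
    intro y hy
    have h1 := hw.sq_sub_le hy (Set.left_mem_Icc.2 h0N)
    rw [hw0, sub_zero] at h1
    exact h1.trans (mul_le_mul_of_nonneg_left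
      (hB ▸ H.integral_deriv_sq_le_gseminormSq hβm hβp hp hw hP) hd0)
  refine ⟨hsup, ?_⟩
  set q : ℕ → ℕ → ℝ := fun i j => betaPW βm βp α (g i j) * deriv w (g i j) with hq
  set R := ∑ i ∈ Finset.Icc 1 N, ∑ j ∈ Finset.Icc 1 p, A i j * r i j ^ 2 with hR
  have hDq : D = ∑ i ∈ Finset.Icc 1 N, ∑ j ∈ Finset.Icc 1 p, A i j * q i j ^ 2 := rfl
  have hele : ∀ i ∈ Finset.Icc 1 N, ∑ j ∈ Finset.Icc 1 p, A i j * q i j ^ 2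
      ≤ (∑ j ∈ Finset.Icc 1 p, A i j * r i j ^ 2)
        + (1 / 4 + |γ| * B * h + c * (h / 2) + c * (h ^ 2 * B / 2))
          * ∑ j ∈ Finset.Icc 1 p, A i j * q i j ^ 2
        + K * (w (x i) - w (x (i - 1))) + γ / 2 * (w (x i) ^ 2 - w (x (i - 1)) ^ 2)
        + c * ((∫ t in (x 0)..(x i), w t) * w (x i)
          - (∫ t in (x 0)..(x (i - 1)), w t) * w (x (i - 1)))
        + c * (h / 2) * (d * (B * D)) * B * (x i - x (i - 1)) := by
    intro i hi
    have h1 := H.lower_order_le hβm hβp hp hh (γ := γ) hc hw hP hsup hi hB rfl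
    have h2 : ∑ j ∈ Finset.Icc 1 p, A i j * q i j ^ 2
        ≤ (∑ j ∈ Finset.Icc 1 p, A i j * r i j ^ 2)
          + 1 / 4 * (∑ j ∈ Finset.Icc 1 p, A i j * q i j ^ 2)
          + K * (∑ j ∈ Finset.Icc 1 p, A i j * q i j)
          + ∑ j ∈ Finset.Icc 1 p, A i j * ((γ * w (g i j) + c * ∫ t in (x 0)..(g i j), w t)
            * q i j) := by
      rw [Finset.mul_sum, Finset.mul_sum, ← Finset.sum_add_distrib, ← Finset.sum_add_distrib,
        ← Finset.sum_add_distrib]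
      refine Finset.sum_le_sum fun j hj => ?_
      have hA := H.weight_pos i hi j hj
      have hqj : q i j = r i j + K + (γ * w (g i j) + c * ∫ t in (x 0)..(g i j), w t) :=
        heq i hi j hj
      have h3 : q i j ^ 2 ≤ r i j ^ 2 + 1 / 4 * q i j ^ 2 + K * q i j
          + (γ * w (g i j) + c * ∫ t in (x 0)..(g i j), w t) * q i j := by
        have h4 : q i j ^ 2 = r i j * q i j + K * q i j
            + (γ * w (g i j) + c * ∫ t in (x 0)..(g i j), w t) * q i j := by
          rw [← add_mul, ← add_mul, ← hqj, sq]
        nlinarith [sq_nonneg (r i j - q i j / 2)]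
      have h5 := mul_le_mul_of_nonneg_left h3 hA.le
      linarith
    rw [H.sum_flux hβm hβp hw hP hi] at h2
    linarith
  have htot := Finset.sum_le_sum hele
  simp only [Finset.sum_add_distrib, ← Finset.mul_sum] at htot
  rw [← hDq, ← hR, sum_length x N, sum_Icc_sub_pred (fun i => w (x i)) N,
    sum_Icc_sub_pred (fun i => w (x i) ^ 2) N,
    sum_Icc_sub_pred (fun i => (∫ t in (x 0)..(x i), w t) * w (x i)) N, hw0, hwN, ← hd] at htot
  have h6 : c * (h ^ 2 * B / 2) ≤ c * (h * B / 2) := by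
    refine mul_le_mul_of_nonneg_left ?_ hc
    have : h ^ 2 ≤ h := by nlinarith
    nlinarith
  have h7 := mul_le_mul_of_nonneg_right h6 hD0
  have h8 := mul_le_mul_of_nonneg_right hsmall hD0
  linarith

end IsQuadratureMesh

theorem eq_first_node_of_step {p N : ℕ} {g : ℕ → ℕ → ℝ} {ρ : ℝ → ℝ}
    (hglue : ∀ i, 1 ≤ i → i < N → g i (p + 1) = g (i + 1) 1)
    (hstep : ∀ i, 1 ≤ i → i ≤ N → ∀ j, 1 ≤ j → j ≤ (if i < N then p else p - 1) →
      ρ (g i j) = ρ (g i (j + 1))) :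
    ∀ i ∈ Finset.Icc 1 N, ∀ j ∈ Finset.Icc 1 p, ρ (g i j) = ρ (g 1 1) := by
  have hrow : ∀ i, 1 ≤ i → i ≤ N → ∀ j, 1 ≤ j → j ≤ (if i < N then p else p - 1) + 1 →
      ρ (g i j) = ρ (g i 1) := by
    intro i hi hiN j hj
    induction j, hj using Nat.le_induction with
    | base => intro _; rfl
    | succ j hj ih => intro hjp; rw [← hstep i hi hiN j hj (by omega), ih (by omega)]
  have hcol : ∀ i, 1 ≤ i → i ≤ N → ρ (g i 1) = ρ (g 1 1) := by
    intro i hi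
    induction i, hi using Nat.le_induction with
    | base => intro _; rfl
    | succ i hi ih =>
      intro hiN
      rw [← hglue i hi (by omega), hrow i hi (by omega) (p + 1) (by omega)
        (by rw [if_pos (by omega)]), ih (by omega)]
  intro i hi j hj
  rw [Finset.mem_Icc] at hi hj
  rw [hrow i hi.1 hi.2 j hj.1 (by split_ifs <;> omega), hcol i hi.1 hi.2]

/-- The square of the discrete energy norm. -/
noncomputable def gnormSq (N p : ℕ) (a b βm βp α : ℝ) (g A : ℕ → ℕ → ℝ) (u : ℝ → ℝ) : ℝ :=
  gseminormSq N p βm βp α g A u + ∫ t in a..b, ((deriv u t) ^ 2 + (u t) ^ 2)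

theorem PiecewiseC1.integral_sq_add_sq {a b : ℝ} {u : ℝ → ℝ} (hu : PiecewiseC1 a b u)
    (hab : a ≤ b) : ∫ t in a..b, ((deriv u t) ^ 2 + (u t) ^ 2)
      = (∫ t in a..b, deriv u t ^ 2) + ∫ t in a..b, u t ^ 2 :=
  intervalIntegral.integral_add (hu.intervalIntegrable_deriv_sq hab) (hu.intervalIntegrable_sq hab)

theorem PiecewiseC1.integral_sub_sq_le {a b : ℝ} {u w : ℝ → ℝ} (hu : PiecewiseC1 a b u)
    (hw : PiecewiseC1 a b w) (hab : a ≤ b) :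
    ∫ t in a..b, ((deriv (fun y => u y - w y) t) ^ 2 + (u t - w t) ^ 2)
      ≤ 2 * (∫ t in a..b, ((deriv u t) ^ 2 + (u t) ^ 2))
        + 2 * ∫ t in a..b, ((deriv w t) ^ 2 + (w t) ^ 2) := by
  have hs := hu.sub hw
  have iu := (hu.intervalIntegrable_deriv_sq hab).add (hu.intervalIntegrable_sq hab)
  have iw := (hw.intervalIntegrable_deriv_sq hab).add (hw.intervalIntegrable_sq hab)
  have ie := (hs.intervalIntegrable_deriv_sq hab).add (hs.intervalIntegrable_sq hab)
  rw [← intervalIntegral.integral_const_mul, ← intervalIntegral.integral_const_mul,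
    ← intervalIntegral.integral_add (iu.const_mul 2) (iw.const_mul 2)]
  obtain ⟨-, S, hS, M, hM⟩ := hu
  obtain ⟨-, S', hS', M', hM'⟩ := hw
  refine intervalIntegral_mono_off_countable hab (hS.union hS') ie
    ((iu.const_mul 2).add (iw.const_mul 2)) fun t ht => ?_
  have hn : t ∉ S ∧ t ∉ S' := by simpa [not_or] using ht.2
  rw [deriv_fun_sub (hM t ⟨ht.1, hn.1⟩).1 (hM' t ⟨ht.1, hn.2⟩).1]
  nlinarith [sq_nonneg (deriv u t + deriv w t), sq_nonneg (u t + w t)]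

namespace IsQuadratureMesh

variable {p N : ℕ} {βm βp α h : ℝ} {x : ℕ → ℝ} {g A : ℕ → ℕ → ℝ} {u w : ℝ → ℝ}

theorem gnormSq_sub_le (H : IsQuadratureMesh p N βm βp α h x g A)
    (hu : PiecewiseC1 (x 0) (x N) u) (hw : PiecewiseC1 (x 0) (x N) w)
    (hud : ∀ i ∈ Finset.Icc 1 N, ∀ j ∈ Finset.Icc 1 p, DifferentiableAt ℝ u (g i j))
    (hwd : ∀ i ∈ Finset.Icc 1 N, ∀ j ∈ Finset.Icc 1 p, DifferentiableAt ℝ w (g i j)) :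
    gnormSq N p (x 0) (x N) βm βp α g A (fun t => u t - w t)
      ≤ 2 * gnormSq N p (x 0) (x N) βm βp α g A u
        + 2 * gnormSq N p (x 0) (x N) βm βp α g A w := by
  have h1 := hu.integral_sub_sq_le hw (mesh_le H.step N.zero_le le_rfl)
  have h2 : gseminormSq N p βm βp α g A (fun t => u t - w t)
      ≤ 2 * gseminormSq N p βm βp α g A u + 2 * gseminormSq N p βm βp α g A w := by
    simp only [gseminormSq, Finset.mul_sum, ← Finset.sum_add_distrib]
    refine Finset.sum_le_sum fun i hi => Finset.sum_le_sum fun j hj => ?_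
    rw [deriv_fun_sub (hud i hi j hj) (hwd i hi j hj), mul_sub]
    set s := betaPW βm βp α (g i j) * deriv u (g i j)
    set t := betaPW βm βp α (g i j) * deriv w (g i j)
    have : (s - t) ^ 2 ≤ 2 * s ^ 2 + 2 * t ^ 2 := by nlinarith [sq_nonneg (s + t)]
    have := mul_le_mul_of_nonneg_left this (H.weight_pos i hi j hj).le
    linarith
  simp only [gnormSq]
  linarith

/-- The flux of `u` at the nodes, corrected by the lower order terms, is bounded by the discrete
energy norm. -/
theorem sum_residual_sq_le (H : IsQuadratureMesh p N βm βp α h x g A) (hβm : 0 < βm)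
    (hβp : 0 < βp) {γ c : ℝ} (hu : PiecewiseC1 (x 0) (x N) u) (hu0 : u (x 0) = 0) :
    ∑ i ∈ Finset.Icc 1 N, ∑ j ∈ Finset.Icc 1 p, A i j *
      (betaPW βm βp α (g i j) * deriv u (g i j) - γ * u (g i j)
        - c * ∫ t in (x 0)..(g i j), u t) ^ 2
      ≤ (3 + 3 * (γ ^ 2 + c ^ 2) * (1 / βm + 1 / βp) * (x N - x 0) ^ 2)
        * gnormSq N p (x 0) (x N) βm βp α g A u := by
  have h0N : x 0 ≤ x N := mesh_le H.step N.zero_le le_rfl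
  set E := gnormSq N p (x 0) (x N) βm βp α g A u with hE
  set d := x N - x 0 with hd
  have hd0 : 0 ≤ d := sub_nonneg.2 h0N
  have hsemi := H.gseminormSq_nonneg u
  have i1 : 0 ≤ ∫ t in (x 0)..(x N), deriv u t ^ 2 :=
    intervalIntegral.integral_nonneg h0N fun _ _ => sq_nonneg _
  have i2 : 0 ≤ ∫ t in (x 0)..(x N), u t ^ 2 :=
    intervalIntegral.integral_nonneg h0N fun _ _ => sq_nonneg _
  have hEeq : E = gseminormSq N p βm βp α g A u
      + ((∫ t in (x 0)..(x N), deriv u t ^ 2) + ∫ t in (x 0)..(x N), u t ^ 2) := by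
    rw [hE, gnormSq, hu.integral_sq_add_sq h0N]
  have hE0 : 0 ≤ E := by linarith
  have hpt : ∀ y ∈ Set.Icc (x 0) (x N), u y ^ 2 ≤ d * E ∧ (∫ t in (x 0)..y, u t) ^ 2 ≤ d * E := by
    intro y hy
    constructor
    · have h1 := hu.sq_sub_le hy (Set.left_mem_Icc.2 h0N)
      rw [hu0, sub_zero] at h1
      exact h1.trans (mul_le_mul_of_nonneg_left (by linarith) hd0)
    · have hy' := hu.mono le_rfl hy.2
      refine (sq_intervalIntegral_le hy.1 (hy'.intervalIntegrable hy.1)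
        (hy'.intervalIntegrable_sq hy.1)).trans (mul_le_mul (by linarith [hy.2]) ?_
          (intervalIntegral.integral_nonneg hy.1 fun _ _ => sq_nonneg _) hd0)
      have h2 : ∫ t in (x 0)..y, u t ^ 2 ≤ ∫ t in (x 0)..(x N), u t ^ 2 :=
        intervalIntegral.integral_mono_interval le_rfl hy.1 hy.2
          (Filter.Eventually.of_forall fun _ => sq_nonneg _) (hu.intervalIntegrable_sq h0N)
      linarith
  have hele : ∀ i ∈ Finset.Icc 1 N, ∑ j ∈ Finset.Icc 1 p, A i j *
      (betaPW βm βp α (g i j) * deriv u (g i j) - γ * u (g i j)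
        - c * ∫ t in (x 0)..(g i j), u t) ^ 2
      ≤ 3 * (∑ j ∈ Finset.Icc 1 p, A i j * (betaPW βm βp α (g i j) * deriv u (g i j)) ^ 2)
        + 3 * ((γ ^ 2 + c ^ 2) * (d * E)) * (1 / βm + 1 / βp) * (x i - x (i - 1)) := by
    intro i hi
    have h1 : 3 * ((γ ^ 2 + c ^ 2) * (d * E)) * ∑ j ∈ Finset.Icc 1 p, A i j
        ≤ 3 * ((γ ^ 2 + c ^ 2) * (d * E)) * (1 / βm + 1 / βp) * (x i - x (i - 1)) :=
      (mul_le_mul_of_nonneg_left (H.sum_weight_le hβm hβp hi) (by positivity)).trans_eq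
        (mul_assoc _ _ _).symm
    refine le_trans ?_ (add_le_add_right h1 _)
    rw [Finset.mul_sum, Finset.mul_sum, ← Finset.sum_add_distrib]
    refine Finset.sum_le_sum fun j hj => ?_
    have hg := H.node_mem i hi j hj
    obtain ⟨k1, k2⟩ := hpt (g i j) ⟨(H.first_le hi).trans hg.1.le, hg.2.le.trans (H.le_last hi)⟩
    set s := betaPW βm βp α (g i j) * deriv u (g i j)
    set y := u (g i j)
    set z := ∫ t in (x 0)..(g i j), u t
    have k3 : (s - γ * y - c * z) ^ 2 ≤ 3 * s ^ 2 + 3 * (γ ^ 2 * y ^ 2) + 3 * (c ^ 2 * z ^ 2) := by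
      nlinarith [sq_nonneg (s + γ * y), sq_nonneg (s + c * z), sq_nonneg (γ * y - c * z)]
    have k4 := mul_le_mul_of_nonneg_left k1 (sq_nonneg γ)
    have k5 := mul_le_mul_of_nonneg_left k2 (sq_nonneg c)
    have k6 : (s - γ * y - c * z) ^ 2 ≤ 3 * s ^ 2 + 3 * ((γ ^ 2 + c ^ 2) * (d * E)) := by
      linarith
    have k7 := mul_le_mul_of_nonneg_left k6 (H.weight_pos i hi j hj).le
    linarith
  have htot := Finset.sum_le_sum hele
  rw [Finset.sum_add_distrib, ← Finset.mul_sum, ← Finset.mul_sum, sum_length x N] at htot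
  refine htot.trans ?_
  have : ∑ i ∈ Finset.Icc 1 N, ∑ j ∈ Finset.Icc 1 p,
      A i j * (betaPW βm βp α (g i j) * deriv u (g i j)) ^ 2 ≤ E := by
    rw [hEeq, gseminormSq]
    linarith
  rw [← hd]
  linarith

theorem gnormSq_le_of_sup (H : IsQuadratureMesh p N βm βp α h x g A) (hβm : 0 < βm)
    (hβp : 0 < βp) (hp : 1 ≤ p) (hw : PiecewiseC1 (x 0) (x N) w)
    (hP : HasPolynomialFlux p N βm βp α x w) {M : ℝ}
    (hM : ∀ y ∈ Set.Icc (x 0) (x N), w y ^ 2 ≤ M) :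
    gnormSq N p (x 0) (x N) βm βp α g A w
      ≤ (1 + (1 / βm + 1 / βp)) * gseminormSq N p βm βp α g A w + (x N - x 0) * M := by
  have h0N : x 0 ≤ x N := mesh_le H.step N.zero_le le_rfl
  have h1 := H.integral_deriv_sq_le_gseminormSq hβm hβp hp hw hP
  have h2 := intervalIntegral.integral_mono_on h0N (hw.intervalIntegrable_sq h0N)
    intervalIntegrable_const hM
  rw [intervalIntegral.integral_const, smul_eq_mul] at h2
  rw [gnormSq, hw.integral_sq_add_sq h0N]
  linarith

end IsQuadratureMesh

/-- for `c > 0` and `A_{i,j} ≥ κ hᵢ`, if `u ∈ W̃_β^{2,∞}` solves the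
interface problem `−(βu′)′ + γu′ + cu = f` with `u(a) = u(b) = 0` and `u_T ∈ U_T` is an IFVM
solution with the same data, then there are `h₀ > 0` and `C > 0`, depending only on `p`,
`β⁻`, `β⁺`, `γ`, `c`, `κ` and `b−a`, such that for `h ≤ h₀` the quasi-optimal bound
`‖u − u_T‖_G ≤ C inf_{v ∈ U_T} ‖u − v‖_G` holds. -/
theorem stmt_12 (p : ℕ) (hp : 1 ≤ p) (βm βp γ c κ d : ℝ)
    (hβm : 0 < βm) (hβp : 0 < βp) (hc : 0 < c) (hκ : 0 < κ) (hd : 0 < d) :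
    ∃ h₀ C : ℝ, 0 < h₀ ∧ 0 < C ∧
    (∀ (N k : ℕ) (a b α hm : ℝ) (x : ℕ → ℝ) (g A : ℕ → ℕ → ℝ),
    b - a = d →
    1 ≤ N →
    1 ≤ k →
    k ≤ N →
    a < b →
    x 0 = a →
    x N = b →
    (∀ i, i < N → x i < x (i + 1)) →
    x (k - 1) < α →
    α < x k →
    (∀ i ∈ Finset.Icc 1 N, ∀ j ∈ Finset.Icc 1 p,
      x (i - 1) < g i j ∧ g i j < x i ∧ g i j ≠ α) →
    (∀ i ∈ Finset.Icc 1 N, ∀ j, 1 ≤ j → j < p → g i j < g i (j + 1)) →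
    (∀ i, 1 ≤ i → i < N → g i (p + 1) = g (i + 1) 1) →
    (∀ i ∈ Finset.Icc 1 N, ∀ j ∈ Finset.Icc 1 p, 0 < A i j) →
    (∀ i ∈ Finset.Icc 1 N, ∀ F : Polynomial ℝ, F.natDegree ≤ 2 * p - 1 →
      ∑ j ∈ Finset.Icc 1 p, A i j * F.eval (g i j)
        = ∫ t in (x (i - 1))..(x i), F.eval t / betaPW βm βp α t) →
    (∀ i ∈ Finset.Icc 1 N, ∀ j ∈ Finset.Icc 1 p, κ * (x i - x (i - 1)) ≤ A i j) →
    (∀ i ∈ Finset.Icc 1 N, x i - x (i - 1) ≤ hm) →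
    hm ≤ h₀ →
    ∀ (f u uT : ℝ → ℝ),
    ContinuousOn f (Set.Ioo a α ∪ Set.Ioo α b) →
    (∃ Mf : ℝ, ∀ t ∈ Set.Icc a b, |f t| ≤ Mf) →
    MemW (2) a b α βm βp u →
    (∀ t, t ∈ Set.Ioo a α ∪ Set.Ioo α b →
      -(betaPW βm βp α t * iteratedDeriv 2 u t) + γ * deriv u t + c * u t = f t) →
    MemUT p N k a b α βm βp x uT →
    (∀ i, 1 ≤ i → i ≤ N → ∀ j, 1 ≤ j → j ≤ (if i < N then p else p - 1) →
      betaPW βm βp α (g i j) * deriv uT (g i j)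
        - betaPW βm βp α (g i (j + 1)) * deriv uT (g i (j + 1))
        + (∫ t in (g i j)..(g i (j + 1)), (γ * deriv uT t + c * uT t))
        = ∫ t in (g i j)..(g i (j + 1)), f t) →
    ∀ v : ℝ → ℝ, MemUT p N k a b α βm βp x v →
    gnorm N p a b βm βp α g A (fun t => u t - uT t)
      ≤ C * gnorm N p a b βm βp α g A (fun t => u t - v t)) := by
  set B := 1 / βm + 1 / βp with hB
  have hB0 : 0 < B := by positivity
  set Λ := |γ| * B + c / 2 * (B ^ 2 * d ^ 2 + 1) + c * B / 2 with hΛ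
  have hΛ0 : 0 ≤ Λ := by positivity
  set C₁ := 3 + 3 * (γ ^ 2 + c ^ 2) * B * d ^ 2 with hC₁
  set C₂ := 1 + B + d * (d * B) with hC₂
  refine ⟨1 / (4 * Λ + 1), Real.sqrt (2 + 4 * (C₂ * C₁)), by positivity, by positivity, ?_⟩
  intro N k a b α hm x g A hbad hN hk hkN hab hx0 hxN hstep hk1 hk2 hgmem hgmono hglue hA hquad
    hAκ hmesh hmh f u uT hf hfb hu hpde huT hscheme v hv
  subst hx0 hxN
  have hhm : 0 < hm :=
    (sub_pos.2 (mesh_lt hstep (by omega : k - 1 < k) hkN)).trans_le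
      (hmesh k (Finset.mem_Icc.2 ⟨hk, hkN⟩))
  have H : IsQuadratureMesh p N βm βp α hm x g A :=
    ⟨hstep, fun i hi j hj => ⟨(hgmem i hi j hj).1, (hgmem i hi j hj).2.1⟩,
      fun i hi j hj => (hgmem i hi j hj).2.2, hA, hquad, hmesh⟩
  have hmΛ : hm * (4 * Λ + 1) ≤ 1 := by rwa [le_div_iff₀ (by positivity)] at hmh
  have hm1 : hm ≤ 1 := by nlinarith [mul_nonneg hhm.le hΛ0]
  have haα : x 0 < α := (mesh_le hstep (Nat.zero_le _) (by omega)).trans_lt hk1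
  have hαb : α < x N := hk2.trans_le (mesh_le hstep hkN le_rfl)
  have hnode : ∀ i ∈ Finset.Icc 1 N, ∀ j ∈ Finset.Icc 1 p, g i j ∈ Set.Ioo (x 0) (x N) :=
    fun i hi j hj => ⟨(H.first_le hi).trans_lt (H.node_mem i hi j hj).1,
      (H.node_mem i hi j hj).2.trans_le (H.le_last hi)⟩
  have hPu := huT.hasPolynomialFlux hp hstep hkN hk1 hk2
  have hPv := hv.hasPolynomialFlux hp hstep hkN hk1 hk2
  have cu := hu.piecewiseC1 haα hαb hβm hβp
  have cT := hPu.piecewiseC1 hβm hβp huT.1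
  have cv := hPv.piecewiseC1 hβm hβp hv.1
  have du : ∀ i ∈ Finset.Icc 1 N, ∀ j ∈ Finset.Icc 1 p, DifferentiableAt ℝ u (g i j) :=
    fun i hi j hj => hu.differentiableAt
      (MemW.mem_Ioo_union (hnode i hi j hj) (H.node_ne i hi j hj))
  have dP : ∀ {z : ℝ → ℝ}, HasPolynomialFlux p N βm βp α x z →
      ∀ i ∈ Finset.Icc 1 N, ∀ j ∈ Finset.Icc 1 p, DifferentiableAt ℝ z (g i j) := by
    intro z hz i hi j hj
    obtain ⟨P, -, hP⟩ := hz i hi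
    exact (hP _ (H.node_mem i hi j hj) (H.node_ne i hi j hj)).1
  have dT := dP hPu
  have dv := dP hPv
  set ρ : ℝ → ℝ := fun t => betaPW βm βp α t * (deriv u t - deriv uT t) - γ * (u t - uT t)
    - c * ∫ y in (x 0)..t, (u y - uT y) with hρ
  have ce := cu.sub cT
  have hconst := eq_first_node_of_step (ρ := ρ) hglue (by
    intro i hi hiN j hj hjp
    have hi' : i ∈ Finset.Icc 1 N := Finset.mem_Icc.2 ⟨hi, hiN⟩
    have hj' : j ∈ Finset.Icc 1 p := Finset.mem_Icc.2 ⟨hj, hjp.trans (by split_ifs <;> omega)⟩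
    obtain ⟨hle, hs, hsα⟩ : g i j ≤ g i (j + 1) ∧ g i (j + 1) ∈ Set.Ioo (x 0) (x N)
        ∧ g i (j + 1) ≠ α := by
      by_cases hlt : j < p
      · have hj1 : j + 1 ∈ Finset.Icc 1 p := Finset.mem_Icc.2 ⟨by omega, hlt⟩
        exact ⟨(hgmono i hi' j hj hlt).le, hnode i hi' _ hj1, H.node_ne i hi' _ hj1⟩
      · have hiN' : i < N := by
          by_contra hcon
          rw [if_neg hcon] at hjp
          omega
        rw [if_pos hiN'] at hjp
        obtain rfl : j = p := by omega
        have hi1 : i + 1 ∈ Finset.Icc 1 N := Finset.mem_Icc.2 ⟨by omega, hiN'⟩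
        have h1 : 1 ∈ Finset.Icc 1 j := Finset.mem_Icc.2 ⟨le_rfl, hp⟩
        rw [hglue i hi hiN']
        exact ⟨((H.node_mem i hi' j hj').2.trans (H.node_mem (i + 1) hi1 1 h1).1).le,
          hnode _ hi1 _ h1, H.node_ne _ hi1 _ h1⟩
    have hr := hnode i hi' j hj'
    have e1 := hu.conservation haα hαb hβm hβp hf hfb hpde hr (H.node_ne i hi' j hj') hs hsα hle
    have e2 := hscheme i hi hiN j hj hjp
    have split : ∀ {z : ℝ → ℝ}, PiecewiseC1 (x 0) (x N) z →
        ∫ t in (g i j)..(g i (j + 1)), (γ * deriv z t + c * z t)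
          = γ * (z (g i (j + 1)) - z (g i j)) + c * ∫ t in (g i j)..(g i (j + 1)), z t := by
      intro z hz
      have hz' := hz.mono hr.1.le hs.2.le
      rw [intervalIntegral.integral_add ((hz'.intervalIntegrable_deriv hle).const_mul γ)
        ((hz'.intervalIntegrable hle).const_mul c), intervalIntegral.integral_const_mul,
        intervalIntegral.integral_const_mul, hz'.integral_deriv hle]
    rw [split cu] at e1
    rw [split cT] at e2
    have e3 : (∫ y in (x 0)..(g i (j + 1)), (u y - uT y)) - ∫ y in (x 0)..(g i j), (u y - uT y)
        = (∫ t in (g i j)..(g i (j + 1)), u t) - ∫ t in (g i j)..(g i (j + 1)), uT t := by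
      rw [intervalIntegral.integral_interval_sub_left
        ((ce.mono le_rfl hs.2.le).intervalIntegrable hs.1.le)
        ((ce.mono le_rfl hr.2.le).intervalIntegrable hr.1.le),
        intervalIntegral.integral_sub ((cu.mono hr.1.le hs.2.le).intervalIntegrable hle)
          ((cT.mono hr.1.le hs.2.le).intervalIntegrable hle)]
    have e4 := congrArg (c * ·) e3
    simp only [hρ]
    simp only [mul_sub] at e4 ⊢
    linarith)
  have cη := cu.sub cv
  have cw := cT.sub cv
  have hPw := hPu.sub hPv
  have hη0 : u (x 0) - v (x 0) = 0 := by rw [hu.2.1, hv.2.1, sub_zero]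
  have hres := H.sum_residual_sq_le hβm hβp (γ := γ) (c := c) cη hη0
  have hw := H.gseminormSq_le_of_residual hβm hβp hp hhm hm1 (γ := γ) (c := c) (K := -ρ (g 1 1))
    (r := fun i j => betaPW βm βp α (g i j) * deriv (fun t => u t - v t) (g i j)
      - γ * (u (g i j) - v (g i j)) - c * ∫ t in (x 0)..(g i j), (u t - v t))
    hc.le hB (by rw [hbad, ← hΛ]; linarith) cw hPw
    (by rw [huT.2.1, hv.2.1, sub_zero]) (by rw [huT.2.2.1, hv.2.2.1, sub_zero]) (by
      intro i hi j hj
      have hg := hnode i hi j hj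
      have iu := (cu.mono le_rfl hg.2.le).intervalIntegrable hg.1.le
      have iT := (cT.mono le_rfl hg.2.le).intervalIntegrable hg.1.le
      have iv := (cv.mono le_rfl hg.2.le).intervalIntegrable hg.1.le
      have := hconst i hi j hj
      rw [← this, deriv_fun_sub (du i hi j hj) (dv i hi j hj),
        deriv_fun_sub (dT i hi j hj) (dv i hi j hj), intervalIntegral.integral_sub iu iv,
        intervalIntegral.integral_sub iT iv]
      simp only [hρ]
      rw [intervalIntegral.integral_sub iu iT]
      ring)
  have hgn := H.gnormSq_le_of_sup hβm hβp hp cw hPw hw.1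
  have htri := H.gnormSq_sub_le cη cw (fun i hi j hj => (du i hi j hj).sub (dv i hi j hj))
    (fun i hi j hj => (dT i hi j hj).sub (dv i hi j hj))
  simp only [sub_sub_sub_cancel_right] at htri
  rw [hbad, ← hB] at hgn hres
  have hC₂0 : 0 ≤ C₂ := by positivity
  have h1 : gnormSq N p (x 0) (x N) βm βp α g A (fun t => uT t - v t)
      ≤ C₂ * (2 * (C₁ * gnormSq N p (x 0) (x N) βm βp α g A (fun t => u t - v t))) := by
    have h2 := mul_le_mul_of_nonneg_left (hw.2.trans (mul_le_mul_of_nonneg_left hres zero_le_two))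
      hC₂0
    refine le_trans (hgn.trans (le_of_eq ?_)) h2
    rw [hC₂]; ring
  change Real.sqrt (gnormSq N p (x 0) (x N) βm βp α g A (fun t => u t - uT t))
    ≤ Real.sqrt (2 + 4 * (C₂ * C₁))
      * Real.sqrt (gnormSq N p (x 0) (x N) βm βp α g A (fun t => u t - v t))
  rw [← Real.sqrt_mul (by positivity)]
  refine Real.sqrt_le_sqrt ?_
  linarith
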